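/- arXiv:1108.2755 — 2 statements merged into one kernel-verified Lean document; each statement's English description precedes it below -/
import Mathlib

section
/- In the setting of the partitioned real matrices A = [[A₁₁, A₁₂],[A₂₁, A₂₂]] and B = [B₁; B₂], with W(s) = A₁₁ + A₁₂(sI − A₂₂)⁻¹A₂₁ and V(s) = B₁ + A₁₂(sI − A₂₂)⁻¹B₂ over ℝ(s), let D̂(s) be the diagonal matrix whose i-th diagonal entry is W(s)ᵢᵢ, and suppose sI − D̂(s) is invertible over ℝ(s). Define the dynamical structure function Q(s) = (sI − D̂(s))⁻¹(W(s) − D̂(s)) and P(s) = (sI − D̂(s))⁻¹V(s). Let G₁ be the top p₁×m block of (sI − A)⁻¹B. Then G₁ = Q(s)·G₁ + P(s). (This is the identity Z₁ = Q Z₁ + P U of Equation (11), showing the dynamical structure function derived from a state realization is consistent with its transfer function.) -/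
open Matrix

theorem Matrix.isUnit_ratFuncX_smul_one_sub_map {F n : Type*} [Field F] [Fintype n]
    [DecidableEq n] (A : Matrix n n F) :
    IsUnit ((RatFunc.X : RatFunc F) • (1 : Matrix n n (RatFunc F)) -
      A.map (algebraMap F (RatFunc F))) := by
  have h : (RatFunc.X : RatFunc F) • (1 : Matrix n n (RatFunc F)) -
      A.map (algebraMap F (RatFunc F)) =
      (algebraMap (Polynomial F) (RatFunc F)).mapMatrix (charmatrix A) := by
    ext i j
    by_cases hij : i = j
    · subst hij
      simp [RatFunc.algebraMap_X, RatFunc.algebraMap_C,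
        RatFunc.algebraMap_eq_C]
    · simp [hij, RatFunc.algebraMap_C, RatFunc.algebraMap_eq_C]
  rw [h, isUnit_iff_isUnit_det, ← RingHom.map_det, isUnit_iff_ne_zero]
  exact RatFunc.algebraMap_ne_zero A.charpoly_monic.ne_zero

/-- Eliminating the hidden state `Z₂` from a partitioned resolvent equation. -/
theorem Matrix.smul_toRows₁_eq_of_resolvent_eq {K l n m : Type*} [CommRing K] [Fintype l]
    [Fintype n] [DecidableEq l] [DecidableEq n] (x : K)
    (A₁₁ : Matrix l l K) (A₁₂ : Matrix l n K) (A₂₁ : Matrix n l K) (A₂₂ : Matrix n n K)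
    (B₁ : Matrix l m K) (B₂ : Matrix n m K) (Z : Matrix (l ⊕ n) m K)
    (h₂₂ : IsUnit (x • (1 : Matrix n n K) - A₂₂))
    (hZ : (x • (1 : Matrix (l ⊕ n) (l ⊕ n) K) - fromBlocks A₁₁ A₁₂ A₂₁ A₂₂) * Z =
      fromRows B₁ B₂) :
    x • Z.toRows₁ =
      (A₁₁ + A₁₂ * (x • (1 : Matrix n n K) - A₂₂)⁻¹ * A₂₁) * Z.toRows₁ +
        (B₁ + A₁₂ * (x • (1 : Matrix n n K) - A₂₂)⁻¹ * B₂) := by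
  rw [← fromRows_toRows Z, Matrix.sub_mul, Matrix.smul_mul, Matrix.one_mul,
    fromBlocks_mul_fromRows] at hZ
  have e₁ : x • Z.toRows₁ = A₁₁ * Z.toRows₁ + A₁₂ * Z.toRows₂ + B₁ := by
    rw [← sub_eq_iff_eq_add']
    exact congrArg toRows₁ hZ
  have e₂ : (x • (1 : Matrix n n K) - A₂₂) * Z.toRows₂ = A₂₁ * Z.toRows₁ + B₂ := by
    rw [Matrix.sub_mul, Matrix.smul_mul, Matrix.one_mul, sub_eq_iff_eq_add, add_right_comm,
      ← sub_eq_iff_eq_add']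
    exact congrArg toRows₂ hZ
  have e₃ : Z.toRows₂ =
      (x • (1 : Matrix n n K) - A₂₂)⁻¹ * (A₂₁ * Z.toRows₁ + B₂) := by
    rw [← e₂, nonsing_inv_mul_cancel_left _ _ ((isUnit_iff_isUnit_det _).1 h₂₂)]
  rw [e₁, e₃]
  simp only [Matrix.mul_add, Matrix.add_mul, Matrix.mul_assoc]
  abel

theorem Matrix.eq_inv_mul_mul_add_of_smul_eq {K l m : Type*} [CommRing K] [Fintype l]
    [DecidableEq l] (x : K) (W D : Matrix l l K) (V Z : Matrix l m K)
    (hD : IsUnit (x • (1 : Matrix l l K) - D)) (hZ : x • Z = W * Z + V) :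
    Z = (x • (1 : Matrix l l K) - D)⁻¹ * (W - D) * Z + (x • (1 : Matrix l l K) - D)⁻¹ * V := by
  have h : (x • (1 : Matrix l l K) - D) * Z = (W - D) * Z + V := by
    rw [Matrix.sub_mul, Matrix.smul_mul, Matrix.one_mul, hZ, Matrix.sub_mul]
    abel
  rw [Matrix.mul_assoc, ← Matrix.mul_add, ← h,
    nonsing_inv_mul_cancel_left _ _ ((isUnit_iff_isUnit_det _).1 hD)]

set_option synthInstance.maxHeartbeats 1000000
set_option maxHeartbeats 1000000

/-- **Equation (11):** for the partitioned state realization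
`A = [[A₁₁, A₁₂],[A₂₁, A₂₂]]`, `B = [B₁; B₂]`, with
`W(s) = A₁₁ + A₁₂(sI − A₂₂)⁻¹A₂₁`, `V(s) = B₁ + A₁₂(sI − A₂₂)⁻¹B₂`,
`D̂(s)` the diagonal part of `W(s)` (with `sI − D̂(s)` invertible over `ℝ(s)`),
`Q(s) = (sI − D̂)⁻¹(W − D̂)` and `P(s) = (sI − D̂)⁻¹V`, the top block `G₁` of
`(sI − A)⁻¹B` satisfies `G₁ = Q·G₁ + P`. -/
theorem dynamical_structure_function_consistency
    (p₁ n₂ m : ℕ)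
    (A₁₁ : Matrix (Fin p₁) (Fin p₁) ℝ) (A₁₂ : Matrix (Fin p₁) (Fin n₂) ℝ)
    (A₂₁ : Matrix (Fin n₂) (Fin p₁) ℝ) (A₂₂ : Matrix (Fin n₂) (Fin n₂) ℝ)
    (B₁ : Matrix (Fin p₁) (Fin m) ℝ) (B₂ : Matrix (Fin n₂) (Fin m) ℝ) :
    letI K := RatFunc ℝ
    letI A' := (Matrix.fromBlocks A₁₁ A₁₂ A₂₁ A₂₂).map (algebraMap ℝ K)
    letI B' := (Matrix.fromRows B₁ B₂).map (algebraMap ℝ K)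
    letI G := ((RatFunc.X : K) • (1 : Matrix (Fin p₁ ⊕ Fin n₂) (Fin p₁ ⊕ Fin n₂) K) - A')⁻¹ * B'
    letI G₁ := G.submatrix Sum.inl id
    letI R₂₂ := ((RatFunc.X : K) • (1 : Matrix (Fin n₂) (Fin n₂) K) -
        A₂₂.map (algebraMap ℝ K))⁻¹
    letI W := A₁₁.map (algebraMap ℝ K) +
        A₁₂.map (algebraMap ℝ K) * R₂₂ * A₂₁.map (algebraMap ℝ K)
    letI V := B₁.map (algebraMap ℝ K) +
        A₁₂.map (algebraMap ℝ K) * R₂₂ * B₂.map (algebraMap ℝ K)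
    letI Dhat := Matrix.diagonal (fun i => W i i)
    letI Q := ((RatFunc.X : K) • (1 : Matrix (Fin p₁) (Fin p₁) K) - Dhat)⁻¹ * (W - Dhat)
    letI P := ((RatFunc.X : K) • (1 : Matrix (Fin p₁) (Fin p₁) K) - Dhat)⁻¹ * V
    IsUnit ((RatFunc.X : K) • (1 : Matrix (Fin p₁) (Fin p₁) K) - Dhat) →
      G₁ = Q * G₁ + P := by
  intro hD
  refine eq_inv_mul_mul_add_of_smul_eq _ _ _ _ _ hD ?_
  refine smul_toRows₁_eq_of_resolvent_eq _ _ _ _ _ _ _ _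
    (isUnit_ratFuncX_smul_one_sub_map A₂₂) ?_
  have hA := isUnit_ratFuncX_smul_one_sub_map (fromBlocks A₁₁ A₁₂ A₂₁ A₂₂)
  rw [← fromBlocks_map, mul_nonsing_inv_cancel_left _ _ ((isUnit_iff_isUnit_det _).1 hA)]
  exact fromRows_map _ _ _
end

section
/- In the setting of the partitioned real matrices A = [[A₁₁, A₁₂],[A₂₁, A₂₂]] and B = [B₁; B₂] over ℝ(s), with W(s) = A₁₁ + A₁₂(sI − A₂₂)⁻¹A₂₁, V(s) = B₁ + A₁₂(sI − A₂₂)⁻¹B₂, D̂(s) the diagonal part of W(s), Q(s) = (sI − D̂(s))⁻¹(W(s) − D̂(s)), and P(s) = (sI − D̂(s))⁻¹V(s) (with sI − D̂(s) invertible over ℝ(s)): every diagonal entry of Q(s) is zero, and every entry of Q(s) and of P(s) is strictly proper, i.e. each entry f ∈ ℝ(s) is zero or satisfies intDegree f < 0. (This is the paper's claim that Q(s) is a square matrix of strictly proper rational functions with zeros on the diagonal, preserving the interpretation of edges as causal dependencies.) -/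
open Matrix

set_option synthInstance.maxHeartbeats 1000000
set_option maxHeartbeats 1000000

section ValuationMatrix

variable {K Γ₀ : Type*} [Field K] [LinearOrderedCommGroupWithZero Γ₀]

theorem Valuation.mul_apply_le_one {l m n : Type*} [Fintype m] (v : Valuation K Γ₀)
    {M : Matrix l m K} {N : Matrix m n K} (hM : ∀ i j, v (M i j) ≤ 1)
    (hN : ∀ i j, v (N i j) ≤ 1) (i : l) (j : n) : v ((M * N) i j) ≤ 1 := by
  rw [Matrix.mul_apply]
  refine v.map_sum_le fun k _ => ?_
  rw [map_mul]
  exact mul_le_one' (hM i k) (hN k j)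

theorem Valuation.mul_apply_lt_one {l m n : Type*} [Fintype m] (v : Valuation K Γ₀)
    {M : Matrix l m K} {N : Matrix m n K} (hM : ∀ i j, v (M i j) < 1)
    (hN : ∀ i j, v (N i j) ≤ 1) (i : l) (j : n) : v ((M * N) i j) < 1 := by
  rw [Matrix.mul_apply]
  refine v.map_sum_lt one_ne_zero fun k _ => ?_
  rw [map_mul]
  exact mul_lt_one_of_lt_of_le (hM i k) (hN k j)

/-- The resolvent of a matrix with integral entries, at a point of valuation greater than `1`,
has entries of valuation less than `1`. -/
theorem Valuation.inv_smul_one_sub_apply_lt_one {n : Type*} [Fintype n] [DecidableEq n]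
    (v : Valuation K Γ₀) {t : K} (ht : 1 < v t) {A : Matrix n n K}
    (hA : ∀ i j, v (A i j) ≤ 1) (i j : n) :
    v ((t • (1 : Matrix n n K) - A)⁻¹ i j) < 1 := by
  by_cases hdet : IsUnit (t • (1 : Matrix n n K) - A).det
  · have hmul := Matrix.mul_nonsing_inv _ hdet
    set M := (t • (1 : Matrix n n K) - A)⁻¹
    have : Nonempty n := ⟨i⟩
    obtain ⟨k, hk⟩ := Finite.exists_max fun k => v (M k j)
    refine (hk i).trans_lt ?_
    by_contra! h
    have hentry : t * M k j = (1 : Matrix n n K) k j + (A * M) k j := by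
      rw [← hmul, sub_mul, Matrix.smul_mul, one_mul]
      simp
    have hle : v (t * M k j) ≤ v (M k j) := by
      rw [hentry]
      refine v.map_add_le ?_ ?_
      · rw [Matrix.one_apply]
        split_ifs
        · simpa using h
        · simp
      · rw [Matrix.mul_apply]
        refine v.map_sum_le fun l _ => ?_
        rw [map_mul]
        exact (mul_le_of_le_one_left' (hA k l)).trans (hk l)
    rw [map_mul] at hle
    exact hle.not_gt (lt_mul_of_one_lt_left (zero_lt_one.trans_le h) ht)
  · simp [Matrix.nonsing_inv_apply_not_isUnit _ hdet]

end ValuationMatrix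

open Classical in
theorem RatFunc.inftyValuation_algebraMap_le_one {F : Type*} [Field F] (c : F) :
    inftyValuation F (algebraMap F (RatFunc F) c) ≤ 1 := by
  rcases eq_or_ne c 0 with rfl | hc
  · simp
  · exact (inftyValuation.C F hc).le

open Classical in
theorem RatFunc.eq_zero_or_intDegree_neg_of_inftyValuation_lt_one {F : Type*} [Field F]
    {f : RatFunc F} (hf : inftyValuation F f < 1) : f = 0 ∨ f.intDegree < 0 := by
  refine or_iff_not_imp_left.2 fun h0 => ?_
  rw [inftyValuation_apply, inftyValuation_of_nonzero F h0, ← WithZero.exp_zero,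
    WithZero.exp_lt_exp] at hf
  exact hf

/-- The dynamical structure function `(Q, P)` of a partitioned state realization,
with `Q(s) = (sI − D̂)⁻¹(W − D̂)` and `P(s) = (sI − D̂)⁻¹V` where `D̂` is the
diagonal part of `W(s) = A₁₁ + A₁₂(sI − A₂₂)⁻¹A₂₁` and
`V(s) = B₁ + A₁₂(sI − A₂₂)⁻¹B₂`, has zeros on the diagonal of `Q`, and every
entry of `Q` and of `P` is strictly proper (zero or of negative `intDegree`). -/
theorem dynamical_structure_function_strictly_proper
    (p₁ n₂ m : ℕ)
    (A₁₁ : Matrix (Fin p₁) (Fin p₁) ℝ) (A₁₂ : Matrix (Fin p₁) (Fin n₂) ℝ)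
    (A₂₁ : Matrix (Fin n₂) (Fin p₁) ℝ) (A₂₂ : Matrix (Fin n₂) (Fin n₂) ℝ)
    (B₁ : Matrix (Fin p₁) (Fin m) ℝ) (B₂ : Matrix (Fin n₂) (Fin m) ℝ) :
    letI K := RatFunc ℝ
    letI R₂₂ := ((RatFunc.X : K) • (1 : Matrix (Fin n₂) (Fin n₂) K) -
        A₂₂.map (algebraMap ℝ K))⁻¹
    letI W := A₁₁.map (algebraMap ℝ K) +
        A₁₂.map (algebraMap ℝ K) * R₂₂ * A₂₁.map (algebraMap ℝ K)
    letI V := B₁.map (algebraMap ℝ K) +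
        A₁₂.map (algebraMap ℝ K) * R₂₂ * B₂.map (algebraMap ℝ K)
    letI Dhat := Matrix.diagonal (fun i => W i i)
    letI Q := ((RatFunc.X : K) • (1 : Matrix (Fin p₁) (Fin p₁) K) - Dhat)⁻¹ * (W - Dhat)
    letI P := ((RatFunc.X : K) • (1 : Matrix (Fin p₁) (Fin p₁) K) - Dhat)⁻¹ * V
    IsUnit ((RatFunc.X : K) • (1 : Matrix (Fin p₁) (Fin p₁) K) - Dhat) →
      (∀ i, Q i i = 0) ∧
      (∀ i j, Q i j = 0 ∨ (Q i j).intDegree < 0) ∧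
      (∀ i j, P i j = 0 ∨ (P i j).intDegree < 0) := by
  classical
  intro _
  set v := RatFunc.inftyValuation ℝ
  have hX : 1 < v (RatFunc.X : RatFunc ℝ) := by
    rw [RatFunc.inftyValuation.X, ← WithZero.exp_zero, WithZero.exp_lt_exp]
    exact zero_lt_one
  have hmap {k l : ℕ} (M : Matrix (Fin k) (Fin l) ℝ) (i j) :
      v (M.map (algebraMap ℝ (RatFunc ℝ)) i j) ≤ 1 :=
    RatFunc.inftyValuation_algebraMap_le_one _
  have hR := fun i j => (v.inv_smul_one_sub_apply_lt_one hX (hmap A₂₂) i j).le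
  have hAR := v.mul_apply_le_one (hmap A₁₂) hR
  have hW := fun i j => v.map_add_le (hmap A₁₁ i j) (v.mul_apply_le_one hAR (hmap A₂₁) i j)
  have hV := fun i j => v.map_add_le (hmap B₁ i j) (v.mul_apply_le_one hAR (hmap B₂) i j)
  have hD (d : Fin p₁ → RatFunc ℝ) (hd : ∀ i, v (d i) ≤ 1) (i j) :
      v (Matrix.diagonal d i j) ≤ 1 := by
    rw [Matrix.diagonal_apply]
    split_ifs
    · exact hd i
    · simp
  have hDhat := hD _ fun i => hW i i
  have hinv := v.inv_smul_one_sub_apply_lt_one hX hDhat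
  refine ⟨fun i => ?_, fun i j => ?_, fun i j => ?_⟩
  · rw [Matrix.smul_one_eq_diagonal, Matrix.diagonal_sub, Matrix.inv_diagonal,
      Matrix.diagonal_mul, Matrix.sub_apply, Matrix.diagonal_apply_eq, sub_self, mul_zero]
  · exact RatFunc.eq_zero_or_intDegree_neg_of_inftyValuation_lt_one
      (v.mul_apply_lt_one hinv (fun i j => v.map_sub_le (hW i j) (hDhat i j)) i j)
  · exact RatFunc.eq_zero_or_intDegree_neg_of_inftyValuation_lt_one
      (v.mul_apply_lt_one hinv hV i j)
end
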